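/- Let P be a finite subset of ℝ^d and let v be a vertex (extreme point) of the convex hull of P. Then there exists a sign vector ε ∈ {-1,1}^d such that v is maximal in P under the partial order ≼_ε defined by x ≼_ε y iff ε_i x_i ≤ ε_i y_i for all i ∈ [d]; that is, there is no y ∈ P, y ≠ v, with ε_i v_i ≤ ε_i y_i for all i ∈ [d]. -/

import Mathlib

theorem vertex_maximal_in_some_orthant_order
    {d : ℕ} (P : Set (Fin d → ℝ)) (hP : P.Finite) (v : Fin d → ℝ)
    (hvP : v ∈ P) (hvert : v ∉ convexHull ℝ (P \ {v})) :
    ∃ ε : Fin d → ℝ, (∀ i, ε i = 1 ∨ ε i = -1) ∧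
      ∀ y ∈ P, y ≠ v → ¬ (∀ i, ε i * v i ≤ ε i * y i) := by
  obtain ⟨f, u, hf, hu⟩ := geometric_hahn_banach_closed_point (convex_convexHull ℝ (P \ {v}))
    ((hP.sdiff (t := {v})).isClosed_convexHull ℝ) hvert
  have hsum (x : Fin d → ℝ) : f x = ∑ i, x i * f (Pi.single i 1) := by
    conv_lhs => rw [pi_eq_sum_univ' x]
    simp [map_sum]
  refine ⟨fun i => if 0 ≤ f (Pi.single i 1) then 1 else -1, fun i => ite_eq_or_eq .., ?_⟩
  intro y hy hyv hle
  have hlt : f y < f v := (hf y (subset_convexHull ℝ _ ⟨hy, hyv⟩)).trans hu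
  refine hlt.not_ge ?_
  rw [hsum v, hsum y]
  refine Finset.sum_le_sum fun i _ => ?_
  have hi := hle i
  dsimp only at hi
  split_ifs at hi with hc
  · exact mul_le_mul_of_nonneg_right (by linarith) hc
  · exact mul_le_mul_of_nonpos_right (by linarith) (not_le.mp hc).le
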